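/- arXiv:2410.00475 — 3 statements merged into one kernel-verified Lean document; each statement's English description precedes it below -/
import Mathlib

section
/- Let n and m be positive natural numbers, let α : Fin n → ℝ and β : Fin n → Fin m → ℝ, and let λ : ℝ. Assume: (i) 0 ≤ α i for all i, and α is monotone (α i ≤ α i' whenever i ≤ i'); (ii) 0 ≤ β i j for all i, j; (iii) for each fixed i, the map j ↦ β i j is monotone; (iv) for each fixed j, the map i ↦ β i j is monotone. Then for all j, j' : Fin m with j' ≤ j, if the set {i : Fin n | λ < α i * β i j'} is nonempty, then the set {i : Fin n | λ < α i * β i j} is also nonempty, and the minimum element of {i | λ < α i * β i j} is less than or equal to the minimum element of {i | λ < α i * β i j'}. (This is the first half of the inverse ratio rule: stronger evidence of access lowers the minimal level of similarity required to establish copying, where the degree of belief in copying given similarity level i and access-evidence strength j equals the product α i * β i j.) -/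
open Classical in
/-- First half of the inverse ratio rule: stronger evidence of access (larger `j`)
lowers the minimal level of similarity `i` required to establish copying, where the
degree of belief in copying given similarity level `i` and access-evidence strength `j`
is the product `α i * β i j`. -/
theorem inverse_ratio_rule_access
    (n m : ℕ) (hn : 0 < n) (hm : 0 < m)
    (α : Fin n → ℝ) (β : Fin n → Fin m → ℝ) (lam : ℝ)
    (hα0 : ∀ i, 0 ≤ α i)
    (hαmono : ∀ i i' : Fin n, i ≤ i' → α i ≤ α i')
    (hβ0 : ∀ i j, 0 ≤ β i j)
    (hβj : ∀ (i : Fin n) (j j' : Fin m), j ≤ j' → β i j ≤ β i j')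
    (hβi : ∀ (i i' : Fin n) (j : Fin m), i ≤ i' → β i j ≤ β i' j)
    (j j' : Fin m) (hjj : j' ≤ j)
    (hne : {i : Fin n | lam < α i * β i j'}.Nonempty) :
    {i : Fin n | lam < α i * β i j}.Nonempty ∧
      ({i : Fin n | lam < α i * β i j}.toFinset).min ≤
        ({i : Fin n | lam < α i * β i j'}.toFinset).min := by
  have hsub : {i : Fin n | lam < α i * β i j'} ⊆ {i : Fin n | lam < α i * β i j} :=
    fun i hi => lt_of_lt_of_le hi (mul_le_mul_of_nonneg_left (hβj i j' j hjj) (hα0 i))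
  exact ⟨hne.mono hsub, Finset.min_mono (Set.toFinset_subset_toFinset.mpr hsub)⟩
end

section
/- Let (Ω, 𝓕, μ) be a probability space, let A and S be measurable events with 0 < μ(A) < 1 and 0 < μ(S), and let γ : ℝ with 1 ≤ γ. Then the conditional probability inequality μ[S | A] ≤ γ * μ[S | Aᶜ] holds if and only if μ[A | S] ≤ γ * μ(A) / (1 + μ(A) * (γ - 1)). -/
open MeasureTheory

/-- Clearing denominators in Bayes' rule: a bound on the likelihood ratio of `x / a` and
`y / (1 - a)` is a bound on the posterior `x / (x + y)`. -/
theorem div_le_mul_div_one_sub_iff {a x y γ : ℝ} (ha0 : 0 < a) (ha1 : a < 1)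
    (hxy : 0 < x + y) (hγ : 0 ≤ γ) :
    x / a ≤ γ * (y / (1 - a)) ↔ x / (x + y) ≤ γ * a / (1 + a * (γ - 1)) := by
  have hd : 0 < 1 + a * (γ - 1) := by nlinarith [mul_nonneg ha0.le hγ]
  rw [← mul_div_assoc, div_le_div_iff₀ ha0 (sub_pos.2 ha1), div_le_div_iff₀ hxy hd]
  constructor <;> intro h <;> linarith

/-- Bayes'-rule equivalence underlying the NAF analysis: the conditional probability
inequality `μ[S | A] ≤ γ * μ[S | Aᶜ]` holds iff
`μ[A | S] ≤ γ * μ(A) / (1 + μ(A) * (γ - 1))`, where conditional probabilities are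
written as ratios of (real-valued) measures. -/
theorem naf_bayes_equivalence {Ω : Type*} [MeasurableSpace Ω]
    (μ : Measure Ω) [IsProbabilityMeasure μ]
    (A S : Set Ω) (hAmeas : MeasurableSet A) (hSmeas : MeasurableSet S)
    (hA0 : 0 < μ A) (hA1 : μ A < 1) (hS0 : 0 < μ S)
    (γ : ℝ) (hγ : 1 ≤ γ) :
    (μ (S ∩ A)).toReal / (μ A).toReal ≤
        γ * ((μ (S ∩ Aᶜ)).toReal / (μ Aᶜ).toReal) ↔
      (μ (A ∩ S)).toReal / (μ S).toReal ≤
        γ * (μ A).toReal / (1 + (μ A).toReal * (γ - 1)) := by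
  have ha0 : 0 < μ.real A := ENNReal.toReal_pos hA0.ne' (measure_ne_top μ A)
  have ha1 : μ.real A < 1 := by
    simpa [measureReal_def] using (ENNReal.toReal_lt_toReal (measure_ne_top μ A) ENNReal.one_ne_top).2 hA1
  have hs : μ.real S = μ.real (S ∩ A) + μ.real (S ∩ Aᶜ) := by
    rw [← Set.sdiff_eq]
    exact (measureReal_inter_add_sdiff hAmeas).symm
  have hs0 : 0 < μ.real S := ENNReal.toReal_pos hS0.ne' (measure_ne_top μ S)
  simp only [← measureReal_def]
  rw [Set.inter_comm A S, probReal_compl_eq_one_sub hAmeas, hs]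
  exact div_le_mul_div_one_sub_iff ha0 ha1 (hs ▸ hs0) (by linarith)
end

section
/- Let Ω be a finite type, let π : Equiv.Perm Ω be a permutation, and let A₀, T : Set Ω. Assume π fixes every element outside A₀ (i.e., for all x ∉ A₀, π x = x), and assume either A₀ ⊆ T or A₀ is disjoint from T. Then for all sets S₁, S₂ : Set Ω, the cross-multiplied proportion identity holds: Nat.card((π '' (S₁ ∩ S₂)) ∩ T) * Nat.card(S₂ ∩ T) = Nat.card(S₁ ∩ S₂ ∩ T) * Nat.card((π '' S₂) ∩ T). In particular, when the denominators are nonzero, the ratio |(π''(S₁ ∩ S₂)) ∩ T| / |(π''S₂) ∩ T| equals |S₁ ∩ S₂ ∩ T| / |S₂ ∩ T|. -/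
/-- A permutation fixing every element outside `A` maps `A` into itself. -/
theorem Equiv.Perm.apply_mem_of_forall_notMem_fixed {Ω : Type*} {π : Equiv.Perm Ω} {A : Set Ω}
    (hfix : ∀ x ∉ A, π x = x) {x : Ω} (hx : x ∈ A) : π x ∈ A := by
  by_contra h
  exact h ((π.injective (hfix _ h)).symm ▸ hx)

/-- A permutation supported on `A` preserves every set that contains `A` or is disjoint
from it. -/
theorem Equiv.Perm.apply_mem_iff_of_subset_or_disjoint {Ω : Type*} {π : Equiv.Perm Ω}
    {A T : Set Ω} (hfix : ∀ x ∉ A, π x = x) (hT : A ⊆ T ∨ _root_.Disjoint A T) (x : Ω) :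
    π x ∈ T ↔ x ∈ T := by
  by_cases hx : x ∈ A
  · have hπx := apply_mem_of_forall_notMem_fixed hfix hx
    rcases hT with h | h
    · exact iff_of_true (h hπx) (h hx)
    · exact iff_of_false (Set.disjoint_left.mp h hπx) (Set.disjoint_left.mp h hx)
  · rw [hfix x hx]

/-- The part inside `T` of the image of `S` has as many elements as the part of `S` inside `T`,
for a permutation preserving `T`. -/
theorem Equiv.Perm.card_image_inter {Ω : Type*} {π : Equiv.Perm Ω} {T : Set Ω}
    (hT : ∀ x, π x ∈ T ↔ x ∈ T) (S : Set Ω) :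
    Nat.card (π '' S ∩ T : Set Ω) = Nat.card (S ∩ T : Set Ω) := by
  have hpre : π ⁻¹' T = T := Set.ext hT
  rw [← Set.image_inter_preimage, hpre, Nat.card_image_of_injective π.injective]

/-- Conditional proportion expressions are invariant under the cluster permutation `π`:
if `π` fixes everything outside `A₀`, and `T` either contains `A₀` or is disjoint from
it, then the cross-multiplied proportion identity holds for all `S₁ S₂`, and hence the
corresponding ratios agree whenever the denominators are nonzero. -/
theorem perm_image_proportion_invariant {Ω : Type*} [Fintype Ω] (π : Equiv.Perm Ω)
    (A₀ T : Set Ω) (hfix : ∀ x ∉ A₀, π x = x)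
    (hT : A₀ ⊆ T ∨ Disjoint A₀ T) :
    ∀ S₁ S₂ : Set Ω,
      Nat.card ((π '' (S₁ ∩ S₂)) ∩ T : Set Ω) * Nat.card ((S₂ ∩ T : Set Ω)) =
          Nat.card ((S₁ ∩ S₂ ∩ T : Set Ω)) * Nat.card ((π '' S₂) ∩ T : Set Ω) ∧
        (Nat.card ((S₂ ∩ T : Set Ω)) ≠ 0 → Nat.card ((π '' S₂) ∩ T : Set Ω) ≠ 0 →
          (Nat.card ((π '' (S₁ ∩ S₂)) ∩ T : Set Ω) : ℝ) /
              (Nat.card ((π '' S₂) ∩ T : Set Ω) : ℝ) =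
            (Nat.card ((S₁ ∩ S₂ ∩ T : Set Ω)) : ℝ) /
              (Nat.card ((S₂ ∩ T : Set Ω)) : ℝ)) := by
  intro S₁ S₂
  have hcard := Equiv.Perm.card_image_inter
    (Equiv.Perm.apply_mem_iff_of_subset_or_disjoint hfix hT)
  rw [hcard, hcard]
  exact ⟨rfl, fun _ _ => rfl⟩
end
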